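/- arXiv:1809.09493 — 8 statements merged into one kernel-verified Lean document; each statement's English description precedes it below -/
import Mathlib

section
/- Let G be a simple graph on n ≥ 2 vertices and let d ≥ 2 be a real number, so that log_d n = (log n)/(log d) > 0. Define a function f on unordered pairs of distinct vertices by: f(i,j) = 2/(log_d n) if i and j are adjacent; f(i,j) = 1 if i and j are non-adjacent, mutually reachable, and dist(i,j) ≥ (log_d n)/2; f(i,j) = 0 if i and j are non-adjacent, mutually reachable, and dist(i,j) < (log_d n)/2. Then for every walk v_0, v_1, …, v_m in G (consecutive vertices adjacent) whose endpoints v_0 ≠ v_m are non-adjacent, one has f(v_0, v_m) ≤ ∑_{j=0}^{m−1} f(v_j, v_{j+1}). -/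
open Classical in
/-- The NEPPC LP assignment: `2 / log_d n` on edges, `1` on non-adjacent reachable
pairs at distance at least `(log_d n)/2`, and `0` on non-adjacent reachable pairs at
distance less than `(log_d n)/2`. -/
noncomputable def fval {V : Type*} [Fintype V] (G : SimpleGraph V) (d : ℝ) (i j : V) : ℝ :=
  if G.Adj i j then 2 / (Real.log (Fintype.card V) / Real.log d)
  else if G.Reachable i j ∧ (Real.log (Fintype.card V) / Real.log d) / 2 ≤ (G.dist i j : ℝ)
    then 1
  else 0

theorem SimpleGraph.Walk.sum_map_fval_darts {V : Type*} [Fintype V] {G : SimpleGraph V} (d : ℝ)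
    {u v : V} (w : G.Walk u v) :
    (w.darts.map fun dt => fval G d dt.toProd.1 dt.toProd.2).sum =
      w.length * (2 / (Real.log (Fintype.card V) / Real.log d)) := by
  induction w with
  | nil => simp
  | cons h p ih =>
    simp only [SimpleGraph.Walk.darts_cons, List.map_cons, List.sum_cons, ih,
      SimpleGraph.Walk.length_cons]
    rw [fval, if_pos h]
    push_cast
    ring

theorem stmt4 {V : Type*} [Fintype V] (G : SimpleGraph V) (d : ℝ) (hd : 2 ≤ d)
    (hn : 2 ≤ Fintype.card V) {v0 vm : V} (w : G.Walk v0 vm)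
    (hne : v0 ≠ vm) (hnadj : ¬ G.Adj v0 vm) :
    fval G d v0 vm ≤ (w.darts.map fun dt => fval G d dt.toProd.1 dt.toProd.2).sum := by
  have hL : 0 < Real.log (Fintype.card V) / Real.log d :=
    div_pos (Real.log_pos (by exact_mod_cast hn)) (Real.log_pos (by linarith))
  rw [w.sum_map_fval_darts, fval, if_neg hnadj]
  split_ifs with h
  · have hdist : (G.dist v0 vm : ℝ) ≤ w.length := by exact_mod_cast SimpleGraph.dist_le w
    rw [← mul_div_assoc, le_div_iff₀ hL]
    linarith [h.2]
  · positivity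
end

section
/- Let λ, α, x_ij, x_jk, x_ik be real numbers with 0 < λ ≤ 1/2, α ≥ (6−3λ)/(1+λ), 0 ≤ x_ij, x_jk, x_ik ≤ 1, x_ik ≤ x_ij + x_jk, and x_ik ≥ 1/3. Then α·((1−λ)(x_ij + x_jk) + λ(1−x_ik)) ≥ 2 − λ. -/
theorem stmt6 (lam α xij xjk xik : ℝ) (hl0 : 0 < lam) (hl : lam ≤ 1 / 2)
    (hα : (6 - 3 * lam) / (1 + lam) ≤ α)
    (hij0 : 0 ≤ xij) (hij1 : xij ≤ 1) (hjk0 : 0 ≤ xjk) (hjk1 : xjk ≤ 1)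
    (hik0 : 0 ≤ xik) (hik1 : xik ≤ 1)
    (htri : xik ≤ xij + xjk) (hik : 1 / 3 ≤ xik) :
    2 - lam ≤ α * ((1 - lam) * (xij + xjk) + lam * (1 - xik)) := by
  have hpos : 0 < 1 + lam := by linarith
  have hcost : (1 + lam) / 3 ≤ (1 - lam) * (xij + xjk) + lam * (1 - xik) := by
    nlinarith [mul_nonneg (by linarith : 0 ≤ 1 - lam) (sub_nonneg.2 htri),
      mul_nonneg (by linarith : 0 ≤ 1 - 2 * lam) (sub_nonneg.2 hik)]
  have hα0 : 0 ≤ α := (div_nonneg (by linarith) hpos.le).trans hα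
  calc 2 - lam = (6 - 3 * lam) / (1 + lam) * ((1 + lam) / 3) := by field_simp; ring
    _ ≤ α * ((1 - lam) * (xij + xjk) + lam * (1 - xik)) :=
      mul_le_mul hα hcost (by linarith) hα0
end

section
/- Let λ, α, x_ij, x_jk, x_ik be real numbers with 0 < λ < 1, α ≥ 1/λ, 0 ≤ x_ij, x_jk, x_ik ≤ 1, x_ik ≤ x_ij + x_jk, x_ij ≤ 1/3, and x_jk ≤ 1/3. Then α·((1−λ)·x_ij + λ(1−x_jk) + λ(1−x_ik)) ≥ 1. -/
theorem stmt7 (lam α xij xjk xik : ℝ) (hl0 : 0 < lam) (hl1 : lam < 1)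
    (hα : 1 / lam ≤ α)
    (hij0 : 0 ≤ xij) (hij1 : xij ≤ 1) (hjk0 : 0 ≤ xjk) (hjk1 : xjk ≤ 1)
    (hik0 : 0 ≤ xik) (hik1 : xik ≤ 1)
    (htri : xik ≤ xij + xjk) (hij : xij ≤ 1 / 3) (hjk : xjk ≤ 1 / 3) :
    1 ≤ α * ((1 - lam) * xij + lam * (1 - xjk) + lam * (1 - xik)) := by
  have hcost : lam ≤ (1 - lam) * xij + lam * (1 - xjk) + lam * (1 - xik) := by
    linarith [mul_nonneg hl0.le (sub_nonneg.2 htri), mul_nonneg hl0.le (sub_nonneg.2 hjk),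
      mul_nonneg hl0.le (sub_nonneg.2 hij), mul_nonneg (sub_nonneg.2 hl1.le) hij0]
  have hα0 : 0 ≤ α := (one_div_pos.2 hl0).le.trans hα
  exact ((div_le_iff₀ hl0).1 hα).trans (mul_le_mul_of_nonneg_left hcost hα0)
end

section
/- Let V be a type, let x : V → V → ℝ be symmetric with x(i,i) = 0 for all i and satisfying the triangle inequality x(i,j) ≤ x(i,l) + x(l,j) for all i, j, l. Let k ≥ 2 be an integer, let E be a finite subset of V with |E| = k, let u ∈ V, and let y ∈ ℝ satisfy: (k−1)·y ≤ ∑_{{i,j} ⊆ E, i ≠ j} x(i,j) (sum over unordered pairs in E), and y ≥ x(i,j) for all i, j ∈ E. Let a ∈ E minimize x(u,·) over E and let z ∈ E maximize x(u,·) over E. Then: (1) y ≤ ∑_{i ∈ E} x(u,i); (2) y ≤ x(u,a) + (k−1)·x(u,z); and (3) y ≥ x(u,z) − x(u,a). -/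
theorem Finset.sum_offDiag_add {V : Type*} [DecidableEq V] (E : Finset V) (f : V → ℝ) :
    ∑ p ∈ E.offDiag, (f p.1 + f p.2) = 2 * ((E.card : ℝ) - 1) * ∑ i ∈ E, f i := by
  have hsplit : ∑ p ∈ E.diag, (f p.1 + f p.2) + ∑ p ∈ E.offDiag, (f p.1 + f p.2) =
      ∑ p ∈ E ×ˢ E, (f p.1 + f p.2) := by
    rw [← Finset.sum_union (Finset.disjoint_diag_offDiag E), Finset.diag_union_offDiag]
  have hdiag : ∑ p ∈ E.diag, (f p.1 + f p.2) = 2 * ∑ i ∈ E, f i := by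
    rw [Finset.sum_diag, Finset.sum_add_distrib]
    ring
  have hprod : ∑ p ∈ E ×ˢ E, (f p.1 + f p.2) = 2 * E.card * ∑ i ∈ E, f i := by
    rw [Finset.sum_product]
    simp only [Finset.sum_add_distrib, Finset.sum_const, nsmul_eq_mul, ← Finset.mul_sum]
    ring
  linarith

theorem stmt8 {V : Type*} [DecidableEq V] (x : V → V → ℝ)
    (hsymm : ∀ i j, x i j = x j i) (hdiag : ∀ i, x i i = 0)
    (htri : ∀ i j l, x i j ≤ x i l + x l j)
    (k : ℕ) (hk : 2 ≤ k) (E : Finset V) (hE : E.card = k)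
    (u : V) (y : ℝ)
    (hy1 : ((k : ℝ) - 1) * y ≤ (∑ p ∈ E.offDiag, x p.1 p.2) / 2)
    (hy2 : ∀ i ∈ E, ∀ j ∈ E, x i j ≤ y)
    (a z : V) (ha : a ∈ E) (hz : z ∈ E)
    (hamin : ∀ i ∈ E, x u a ≤ x u i) (hzmax : ∀ i ∈ E, x u i ≤ x u z) :
    y ≤ ∑ i ∈ E, x u i ∧
    y ≤ x u a + ((k : ℝ) - 1) * x u z ∧
    x u z - x u a ≤ y := by
  have hk1 : (0 : ℝ) < (k : ℝ) - 1 := by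
    have : (2 : ℝ) ≤ k := by exact_mod_cast hk
    linarith
  have hsum : y ≤ ∑ i ∈ E, x u i := by
    have hle : ∑ p ∈ E.offDiag, x p.1 p.2 ≤ ∑ p ∈ E.offDiag, (x u p.1 + x u p.2) :=
      Finset.sum_le_sum fun p _ ↦ by
        rw [hsymm u p.1]
        exact htri p.1 p.2 u
    rw [Finset.sum_offDiag_add, hE] at hle
    exact le_of_mul_le_mul_left (by linarith) hk1
  refine ⟨hsum, hsum.trans ?_, ?_⟩
  · rw [← Finset.add_sum_erase E _ ha]
    have hcard : ((E.erase a).card : ℝ) = (k : ℝ) - 1 := by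
      rw [Finset.cast_card_erase_of_mem ha, hE]
    have hle := Finset.sum_le_card_nsmul (E.erase a) (x u) (x u z)
      fun i hi ↦ hzmax i (Finset.mem_of_mem_erase hi)
    rw [nsmul_eq_mul, hcard] at hle
    linarith
  · linarith [htri u z a, hy2 a ha z hz]
end

section
/- Let V be a finite set, u-irrelevant; let x : V → ℝ, let γ, β ∈ ℝ, let T and U be disjoint finite subsets of V with x(i) ≤ γ for all i ∈ T and x(i) > γ for all i ∈ U, and let z ∈ U. Let k ≥ 2 be an integer and define P = { E ⊆ T ∪ U : |E| = k, z ∈ E, E ∩ T ≠ ∅, and x(i) ≤ x(z) for all i ∈ E }. Suppose T is nonempty, ∑_{i ∈ T} x(i) < β·|T|, and P is nonempty. Then ∑_{E ∈ P} (min_{i ∈ E} x(i)) < β·|P|. -/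
theorem Finset.map_swap_eq_self {V : Type*} [DecidableEq V] {T : Finset V} {i j : V}
    (hi : i ∈ T) (hj : j ∈ T) : T.map (Equiv.swap i j).toEmbedding = T := by
  refine Finset.eq_of_subset_of_card_le (fun a ha => ?_) (by simp)
  obtain ⟨b, hb, rfl⟩ := Finset.mem_map.1 ha
  simp only [Equiv.coe_toEmbedding, Equiv.swap_apply_def]
  split_ifs <;> assumption

/-- If a family of finite sets meeting `T` is invariant under transpositions of elements of `T`,
then the mean over the family of the averages of `x` on `E ∩ T` is the average of `x` on `T`. -/
theorem Finset.card_mul_sum_average_inter {V : Type*} [DecidableEq V] (x : V → ℝ) (T : Finset V)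
    (P : Finset (Finset V)) (hne : ∀ E ∈ P, (E ∩ T).Nonempty)
    (hswap : ∀ i ∈ T, ∀ j ∈ T, ∀ E ∈ P, E.map (Equiv.swap i j).toEmbedding ∈ P) :
    (T.card : ℝ) * ∑ E ∈ P, ((E ∩ T).card : ℝ)⁻¹ * ∑ i ∈ E ∩ T, x i
      = P.card * ∑ i ∈ T, x i := by
  set c : V → ℝ := fun i => ∑ E ∈ P, if i ∈ E then ((E ∩ T).card : ℝ)⁻¹ else 0 with hc
  have weighted (y : V → ℝ) :
      ∑ E ∈ P, ((E ∩ T).card : ℝ)⁻¹ * ∑ i ∈ E ∩ T, y i = ∑ i ∈ T, c i * y i := by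
    simp only [hc, Finset.sum_mul]
    rw [Finset.sum_comm]
    refine Finset.sum_congr rfl fun E _ => ?_
    rw [Finset.mul_sum, Finset.inter_comm, ← Finset.filter_mem_eq_inter, Finset.sum_filter]
    exact Finset.sum_congr rfl fun i _ => by split_ifs <;> simp
  have const : ∀ i ∈ T, ∀ j ∈ T, c i = c j := by
    intro i hi j hj
    refine Finset.sum_bij' (fun E _ => E.map (Equiv.swap i j).toEmbedding)
      (fun E _ => E.map (Equiv.swap i j).toEmbedding) (hswap i hi j hj) (hswap i hi j hj)
      ?_ ?_ ?_
    · intro E _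
      ext a
      simp [Finset.mem_map_equiv]
    · intro E _
      ext a
      simp [Finset.mem_map_equiv]
    · intro E _
      have hcard : (E.map (Equiv.swap i j).toEmbedding ∩ T).card = (E ∩ T).card := by
        conv_lhs => rw [← Finset.map_swap_eq_self hi hj, ← Finset.map_inter, Finset.card_map]
      simp only [hcard, Finset.mem_map_equiv, Equiv.symm_swap, Equiv.swap_apply_right]
  have total : ∑ i ∈ T, c i = P.card := by
    have h := weighted fun _ => 1
    simp only [mul_one] at h
    rw [← h, Finset.card_eq_sum_ones, Nat.cast_sum]
    refine Finset.sum_congr rfl fun E hE => ?_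
    have : ((E ∩ T).card : ℝ) ≠ 0 := by exact_mod_cast (hne E hE).card_pos.ne'
    simp [this]
  rw [weighted, ← total, Finset.mul_sum, Finset.mul_sum]
  refine Finset.sum_congr rfl fun i hi => ?_
  rw [Finset.sum_congr rfl fun j hj => const j hj i hi, Finset.sum_const, nsmul_eq_mul, mul_assoc]

theorem Finset.sInf_image_le_average {V : Type*} (x : V → ℝ) {E S : Finset V}
    (hSE : S ⊆ E) (hS : S.Nonempty) :
    sInf (x '' ↑E) ≤ (S.card : ℝ)⁻¹ * ∑ i ∈ S, x i := by
  have hpos : (0 : ℝ) < S.card := by exact_mod_cast hS.card_pos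
  rw [inv_mul_eq_div, le_div_iff₀ hpos, mul_comm, ← nsmul_eq_mul]
  exact Finset.card_nsmul_le_sum _ _ _ fun i hi =>
    csInf_le (E.finite_toSet.image x).bddBelow ⟨i, hSE hi, rfl⟩

theorem stmt11 {V : Type*} [DecidableEq V] (x : V → ℝ) (γ β : ℝ)
    (T U : Finset V) (hdisj : Disjoint T U)
    (hTγ : ∀ i ∈ T, x i ≤ γ) (hUγ : ∀ i ∈ U, γ < x i)
    (z : V) (hz : z ∈ U) (k : ℕ) (hk : 2 ≤ k)
    (P : Finset (Finset V))
    (hP : P = ((T ∪ U).powersetCard k).filter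
      (fun E => z ∈ E ∧ (E ∩ T).Nonempty ∧ ∀ i ∈ E, x i ≤ x z))
    (hTne : T.Nonempty) (hsum : ∑ i ∈ T, x i < β * T.card)
    (hPne : P.Nonempty) :
    ∑ E ∈ P, sInf (x '' ↑E) < β * P.card := by
  have hzT : z ∉ T := fun h => Finset.disjoint_left.1 hdisj h hz
  have hne : ∀ E ∈ P, (E ∩ T).Nonempty := by
    intro E hE
    rw [hP, Finset.mem_filter] at hE
    exact hE.2.2.1
  have hswap : ∀ i ∈ T, ∀ j ∈ T, ∀ E ∈ P, E.map (Equiv.swap i j).toEmbedding ∈ P := by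
    intro i hi j hj E hE
    rw [hP, Finset.mem_filter, Finset.mem_powersetCard] at hE ⊢
    obtain ⟨⟨hsub, hcard⟩, hzE, hET, hmax⟩ := hE
    have hzi : z ≠ i := fun h => hzT (h ▸ hi)
    have hzj : z ≠ j := fun h => hzT (h ▸ hj)
    refine ⟨⟨?_, by rwa [Finset.card_map]⟩, ?_, ?_, ?_⟩
    · rw [← Finset.map_swap_eq_self (Finset.mem_union_left U hi) (Finset.mem_union_left U hj)]
      exact Finset.map_subset_map.2 hsub
    · rwa [Finset.mem_map_equiv, Equiv.symm_swap, Equiv.swap_apply_of_ne_of_ne hzi hzj]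
    · rw [← Finset.map_swap_eq_self hi hj, ← Finset.map_inter]
      exact hET.map
    · intro a ha
      by_cases haT : a ∈ T
      · exact (hTγ a haT).trans (hUγ z hz).le
      · rw [Finset.mem_map_equiv, Equiv.symm_swap, Equiv.swap_apply_of_ne_of_ne
          (ne_of_mem_of_not_mem hi haT).symm (ne_of_mem_of_not_mem hj haT).symm] at ha
        exact hmax a ha
  have hle := Finset.sum_le_sum fun E hE =>
    Finset.sInf_image_le_average x (Finset.inter_subset_left (s₁ := E) (s₂ := T)) (hne E hE)
  have hTpos : (0 : ℝ) < T.card := by exact_mod_cast hTne.card_pos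
  have hPpos : (0 : ℝ) < P.card := by exact_mod_cast hPne.card_pos
  refine lt_of_mul_lt_mul_left ?_ hTpos.le
  calc (T.card : ℝ) * ∑ E ∈ P, sInf (x '' ↑E)
      ≤ T.card * ∑ E ∈ P, ((E ∩ T).card : ℝ)⁻¹ * ∑ i ∈ E ∩ T, x i := by gcongr
    _ = P.card * ∑ i ∈ T, x i := Finset.card_mul_sum_average_inter x T P hne hswap
    _ < P.card * (β * T.card) := by gcongr
    _ = T.card * (β * P.card) := by ring
end

section
/- Let k ≥ 2 be an integer, let T be a finite set with |T| ≥ k−1, let x : T → ℝ, and for each (k−1)-element subset S of T let y(S), w⁺(S), w⁻(S) be real numbers with w⁺(S) ≥ 0, w⁻(S) ≥ 0, w⁺(S) + w⁻(S) = 1, y(S) ≥ x(i) for all i ∈ S, and y(S) ≤ 1/2. If ∑_{i ∈ T} x(i) ≥ |T|/(4(k−1)), then ∑_{S ⊆ T, |S| = k−1} ( w⁺(S)·y(S) + w⁻(S)·(1 − y(S)) ) ≥ C(|T|, k−1)/(4(k−1)), where C(·,·) denotes the binomial coefficient. -/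
/-- The number of `(m + 1)`-element subsets of `T` containing a given element of `T`. -/
theorem card_filter_mem_powersetCard_succ {V : Type*} [DecidableEq V] {T : Finset V} {i : V}
    (hi : i ∈ T) (m : ℕ) :
    ((T.powersetCard (m + 1)).filter (i ∈ ·)).card = (T.card - 1).choose m := by
  rw [← Finset.card_erase_of_mem hi, ← Finset.card_powersetCard]
  refine Finset.card_bij' (fun S _ => S.erase i) (fun S _ => insert i S) ?_ ?_ ?_ ?_
  · intro S hS
    simp only [Finset.mem_filter, Finset.mem_powersetCard] at hS ⊢
    exact ⟨Finset.erase_subset_erase i hS.1.1,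
      by rw [Finset.card_erase_of_mem hS.2, hS.1.2, Nat.add_sub_cancel]⟩
  · intro S hS
    simp only [Finset.mem_filter, Finset.mem_powersetCard, Finset.subset_erase] at hS ⊢
    exact ⟨⟨Finset.insert_subset hi hS.1.1, by rw [Finset.card_insert_of_notMem hS.1.2, hS.2]⟩,
      Finset.mem_insert_self i S⟩
  · intro S hS
    exact Finset.insert_erase (Finset.mem_filter.1 hS).2
  · intro S hS
    simp only [Finset.mem_powersetCard, Finset.subset_erase] at hS
    exact Finset.erase_insert hS.1.2

theorem sum_powersetCard_succ_sum {V : Type*} [DecidableEq V] (T : Finset V) (m : ℕ)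
    (x : V → ℝ) :
    ∑ S ∈ T.powersetCard (m + 1), ∑ i ∈ S, x i =
      ((T.card - 1).choose m : ℝ) * ∑ i ∈ T, x i := by
  rw [Finset.sum_comm' (t' := T) (s' := fun i => (T.powersetCard (m + 1)).filter (i ∈ ·)),
    Finset.mul_sum]
  · refine Finset.sum_congr rfl fun i hi => ?_
    rw [Finset.sum_const, card_filter_mem_powersetCard_succ hi, nsmul_eq_mul]
  · intro S i
    simp only [Finset.mem_filter, Finset.mem_powersetCard]
    exact ⟨fun h => ⟨h, h.1.1 h.2⟩, fun h => h.1⟩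

theorem stmt13 {V : Type*} [DecidableEq V] (k : ℕ) (hk : 2 ≤ k)
    (T : Finset V) (hT : k - 1 ≤ T.card)
    (x : V → ℝ) (y wp wm : Finset V → ℝ)
    (hw : ∀ S ∈ T.powersetCard (k - 1), 0 ≤ wp S ∧ 0 ≤ wm S ∧ wp S + wm S = 1)
    (hyx : ∀ S ∈ T.powersetCard (k - 1), ∀ i ∈ S, x i ≤ y S)
    (hy2 : ∀ S ∈ T.powersetCard (k - 1), y S ≤ 1 / 2)
    (hsum : (T.card : ℝ) / (4 * ((k : ℝ) - 1)) ≤ ∑ i ∈ T, x i) :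
    (T.card.choose (k - 1) : ℝ) / (4 * ((k : ℝ) - 1))
      ≤ ∑ S ∈ T.powersetCard (k - 1), (wp S * y S + wm S * (1 - y S)) := by
  obtain ⟨m, rfl⟩ : ∃ m, k = m + 2 := ⟨k - 2, by omega⟩
  obtain ⟨n, hn⟩ : ∃ n, T.card = n + 1 := ⟨T.card - 1, by omega⟩
  rw [show m + 2 - 1 = m + 1 from rfl] at *
  have hk1 : ((m + 2 : ℕ) : ℝ) - 1 = m + 1 := by push_cast; ring
  rw [hk1] at hsum ⊢
  have hm : (0 : ℝ) < m + 1 := by positivity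
  have hcost : ∑ S ∈ T.powersetCard (m + 1), y S ≤
      ∑ S ∈ T.powersetCard (m + 1), (wp S * y S + wm S * (1 - y S)) := by
    refine Finset.sum_le_sum fun S hS => ?_
    obtain ⟨-, h0, h1⟩ := hw S hS
    have hy := hy2 S hS
    rw [show wp S = 1 - wm S by linarith]
    nlinarith
  refine le_trans ?_ hcost
  have hxy : ∑ S ∈ T.powersetCard (m + 1), ∑ i ∈ S, x i ≤
      ((m : ℝ) + 1) * ∑ S ∈ T.powersetCard (m + 1), y S := by
    rw [Finset.mul_sum]
    refine Finset.sum_le_sum fun S hS => ?_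
    have h := Finset.sum_le_card_nsmul S x (y S) (hyx S hS)
    rw [(Finset.mem_powersetCard.1 hS).2, nsmul_eq_mul] at h
    exact_mod_cast h
  rw [sum_powersetCard_succ_sum, hn, Nat.add_sub_cancel] at hxy
  rw [hn] at hsum ⊢
  have hchoose : ((n : ℝ) + 1) * n.choose m = (n + 1).choose (m + 1) * ((m : ℝ) + 1) := by
    exact_mod_cast Nat.add_one_mul_choose_eq n m
  refine le_of_mul_le_mul_left ?_ hm
  calc ((m : ℝ) + 1) * ((n + 1).choose (m + 1) / (4 * (m + 1)))
      = n.choose m * (((n + 1 : ℕ) : ℝ) / (4 * (m + 1))) := by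
        push_cast
        linear_combination -hchoose / (4 * ((m : ℝ) + 1))
    _ ≤ n.choose m * ∑ i ∈ T, x i := by gcongr
    _ ≤ _ := hxy
end

section
/- Let V be a finite set with |V| = n, let k ≥ 2 be an integer, and let pos be a predicate on k-element subsets of V. For a 2-coloring c : V → Bool, define mistakes(c) as the number of k-element subsets E with pos(E) true on which c is not constant, plus the number of k-element subsets E with pos(E) false on which c is constant. Let c : V → Bool and let K be a (k−1)-element subset of V on which c is constant with common value b. Define c_K : V → Bool by c_K(u) = b if u ∈ K or pos(K ∪ {u}) holds (for u ∉ K), and c_K(u) = ¬b otherwise. Let D = { u ∈ V ∖ K : c_K(u) ≠ c(u) }. Then mistakes(c_K) ≤ mistakes(c) + |D|·C(n−1, k−1), where C(·,·) denotes the binomial coefficient. -/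
open Classical in
/-- The number of 2-clustering mistakes for a complete unweighted `k`-uniform
MotifCC instance: the number of positive `k`-element subsets on which the coloring
`c` is not constant, plus the number of negative `k`-element subsets on which `c`
is constant. -/
noncomputable def mistakes {V : Type*} [Fintype V] (k : ℕ) (pos : Finset V → Prop)
    (c : V → Bool) : ℕ :=
  ((Finset.univ.powersetCard k).filter
      (fun E => pos E ∧ ¬ (∀ i ∈ E, ∀ j ∈ E, c i = c j))).card +
  ((Finset.univ.powersetCard k).filter
      (fun E => ¬ pos E ∧ (∀ i ∈ E, ∀ j ∈ E, c i = c j))).card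

open Classical in
/-- The `k`-element subsets on which the coloring `c` makes a mistake. -/
noncomputable def mistakeSet {V : Type*} [Fintype V] (k : ℕ) (pos : Finset V → Prop)
    (c : V → Bool) : Finset (Finset V) :=
  (Finset.univ.powersetCard k).filter (fun E => ¬ (pos E ↔ ∀ i ∈ E, ∀ j ∈ E, c i = c j))

theorem mem_mistakeSet {V : Type*} [Fintype V] {k : ℕ} {pos : Finset V → Prop}
    {c : V → Bool} {E : Finset V} :
    E ∈ mistakeSet k pos c ↔
      E ∈ Finset.univ.powersetCard k ∧ ¬ (pos E ↔ ∀ i ∈ E, ∀ j ∈ E, c i = c j) := by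
  classical
  exact Finset.mem_filter

open Classical in
/-- The two kinds of mistakes are disjoint, so they can be counted together. -/
theorem mistakes_eq_card_mistakeSet {V : Type*} [Fintype V] (k : ℕ) (pos : Finset V → Prop)
    (c : V → Bool) : mistakes k pos c = (mistakeSet k pos c).card := by
  unfold mistakes mistakeSet
  rw [← Finset.card_union_of_disjoint, ← Finset.filter_or]
  · congr 1
    refine Finset.filter_congr fun E _ => ?_
    tauto
  · refine Finset.disjoint_filter.2 fun E _ h h' => h'.1 h.1

/-- At most `(|V| - 1).choose (k - 1)` sets of size `k` contain a given element. -/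
theorem card_filter_mem_powersetCard_le {V : Type*} [Fintype V] [DecidableEq V] (k : ℕ) (u : V) :
    ((Finset.univ.powersetCard k).filter (fun E => u ∈ E)).card ≤
      (Fintype.card V - 1).choose (k - 1) := by
  have h : (Finset.univ.powersetCard k).filter (fun E => u ∈ E) ⊆
      ((Finset.univ.erase u).powersetCard (k - 1)).image (insert u) := by
    intro E hE
    obtain ⟨hE, hu⟩ := Finset.mem_filter.1 hE
    refine Finset.mem_image.2 ⟨E.erase u, Finset.mem_powersetCard.2
      ⟨Finset.erase_subset_erase u (Finset.subset_univ E), ?_⟩, Finset.insert_erase hu⟩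
    rw [Finset.card_erase_of_mem hu, (Finset.mem_powersetCard.1 hE).2]
  refine (Finset.card_le_card h).trans (Finset.card_image_le.trans ?_)
  rw [Finset.card_powersetCard, Finset.card_erase_of_mem (Finset.mem_univ u), Finset.card_univ]

/-- Recoloring the vertices of `D` creates at most `(|V| - 1).choose (k - 1)` new mistakes per
recolored vertex. -/
theorem mistakes_le_add_of_eq_off {V : Type*} [Fintype V] [DecidableEq V] (k : ℕ)
    (pos : Finset V → Prop) (c c' : V → Bool) (D : Finset V) (h : ∀ u ∉ D, c' u = c u) :
    mistakes k pos c' ≤ mistakes k pos c + D.card * (Fintype.card V - 1).choose (k - 1) := by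
  have hunion : (D.biUnion fun u => (Finset.univ.powersetCard k).filter (fun E => u ∈ E)).card ≤
      D.card * (Fintype.card V - 1).choose (k - 1) :=
    Finset.card_biUnion_le_card_mul _ _ _ fun u _ => card_filter_mem_powersetCard_le k u
  rw [mistakes_eq_card_mistakeSet, mistakes_eq_card_mistakeSet]
  grw [← hunion, ← Finset.card_union_le]
  refine Finset.card_le_card fun E hE => ?_
  rw [mem_mistakeSet] at hE
  rw [Finset.mem_union, mem_mistakeSet, Finset.mem_biUnion]
  by_cases hD : ∃ u ∈ D, u ∈ E
  · obtain ⟨u, huD, huE⟩ := hD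
    exact Or.inr ⟨u, huD, Finset.mem_filter.2 ⟨hE.1, huE⟩⟩
  · have hEq : ∀ u ∈ E, c' u = c u := fun u hu => h u fun huD => hD ⟨u, huD, hu⟩
    refine Or.inl ⟨hE.1, fun hc => hE.2 (hc.trans ?_)⟩
    refine forall₂_congr fun i hi => forall₂_congr fun j hj => ?_
    rw [hEq i hi, hEq j hj]

open Classical in
theorem stmt14 {V : Type*} [Fintype V] [DecidableEq V] (n k : ℕ)
    (hn : Fintype.card V = n) (hk : 2 ≤ k)
    (pos : Finset V → Prop) (c : V → Bool)
    (K : Finset V) (hK : K.card = k - 1) (b : Bool) (hb : ∀ v ∈ K, c v = b)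
    (cK : V → Bool)
    (hcK : ∀ u : V, cK u = if u ∈ K ∨ pos (insert u K) then b else !b)
    (D : Finset V) (hD : D = Finset.univ.filter (fun u => u ∉ K ∧ cK u ≠ c u)) :
    mistakes k pos cK ≤ mistakes k pos c + D.card * (n - 1).choose (k - 1) := by
  subst hn
  refine mistakes_le_add_of_eq_off k pos c cK D fun u hu => ?_
  by_cases huK : u ∈ K
  · rw [hcK, if_pos (Or.inl huK), hb u huK]
  · by_contra hne
    exact hu (hD ▸ Finset.mem_filter.2 ⟨Finset.mem_univ u, huK, hne⟩)
end

section
/- Let V be a finite set, let k ≥ 2 be an integer, and let pos be a predicate on k-element subsets of V. For a 2-coloring c : V → Bool, define mistakes(c) as the number of k-element subsets E with pos(E) true on which c is not constant, plus the number of k-element subsets E with pos(E) false on which c is constant. For each (k−1)-element subset K on which c is constant with common value b_K, define d_K = |{ u ∈ V ∖ K : (pos(K ∪ {u}) and c(u) ≠ b_K) or (¬pos(K ∪ {u}) and c(u) = b_K) }|. Then ∑_K d_K ≤ k·mistakes(c), where the sum is over all (k−1)-element subsets K on which c is constant. -/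
open Classical in
theorem stmt15 {V : Type*} [Fintype V] [DecidableEq V] (k : ℕ) (hk : 2 ≤ k)
    (pos : Finset V → Prop) (c : V → Bool) :
    ∑ K ∈ (Finset.univ.powersetCard (k - 1)).filter
        (fun K => ∀ i ∈ K, ∀ j ∈ K, c i = c j),
      (Finset.univ.filter (fun u => u ∉ K ∧ ∃ i ∈ K,
          ((pos (insert u K) ∧ c u ≠ c i) ∨ (¬ pos (insert u K) ∧ c u = c i)))).card
      ≤ k * mistakes k pos c := by
  set A := (Finset.univ.powersetCard k).filter
    (fun E : Finset V => pos E ∧ ¬ (∀ i ∈ E, ∀ j ∈ E, c i = c j)) with hA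
  set B := (Finset.univ.powersetCard k).filter
    (fun E : Finset V => ¬ pos E ∧ (∀ i ∈ E, ∀ j ∈ E, c i = c j)) with hB
  have hdisj : Disjoint A B := by
    rw [Finset.disjoint_left]
    intro E hEA hEB
    exact (Finset.mem_filter.1 hEB).2.1 (Finset.mem_filter.1 hEA).2.1
  have hmistakes : mistakes k pos c = A.card + B.card := by
    rw [hA, hB, mistakes]
    congr!
  have hcard : ((A ∪ B).sigma fun E => E).card = k * mistakes k pos c := by
    rw [Finset.card_sigma, hmistakes, ← Finset.card_union_of_disjoint hdisj, mul_comm]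
    refine Finset.sum_const_nat fun E hE => ?_
    rcases Finset.mem_union.1 hE with h | h <;>
      exact (Finset.mem_powersetCard.1 (Finset.mem_filter.1 h).1).2
  rw [← hcard, ← Finset.card_sigma]
  refine Finset.card_le_card_of_injOn (fun p => ⟨insert p.2 p.1, p.2⟩) ?_ ?_
  · rintro ⟨K, u⟩ h
    simp only [Finset.coe_sigma, Set.mem_sigma_iff, Finset.mem_coe, Finset.mem_filter,
      Finset.mem_powersetCard, Finset.mem_univ, true_and] at h
    obtain ⟨⟨⟨-, hK⟩, hconst⟩, hu, i, hi, hmis⟩ := h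
    have hKu : (insert u K).card = k := by
      rw [Finset.card_insert_of_notMem hu, hK]
      omega
    simp only [Finset.coe_sigma, Set.mem_sigma_iff, Finset.mem_coe, Finset.mem_union, hA, hB,
      Finset.mem_filter, Finset.mem_powersetCard, Finset.subset_univ, hKu, true_and,
      Finset.mem_insert_self, and_true]
    rcases hmis with ⟨hp, hne⟩ | ⟨hp, heq⟩
    · exact Or.inl ⟨hp, fun h =>
        hne (h u (Finset.mem_insert_self u K) i (Finset.mem_insert_of_mem hi))⟩
    · have hval : ∀ x ∈ insert u K, c x = c i := by
        intro x hx
        rcases Finset.mem_insert.1 hx with rfl | hx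
        · exact heq
        · exact hconst x hx i hi
      exact Or.inr ⟨hp, fun x hx y hy => (hval x hx).trans (hval y hy).symm⟩
  · rintro ⟨K, u⟩ h ⟨L, v⟩ h' heq
    simp only [Finset.coe_sigma, Set.mem_sigma_iff, Finset.mem_coe, Finset.mem_filter,
      Finset.mem_univ, true_and] at h h'
    simp only [Sigma.mk.injEq, heq_eq_eq] at heq
    obtain ⟨hins, rfl⟩ := heq
    have hKL : K = L := by
      rw [← Finset.erase_insert h.2.1, hins, Finset.erase_insert h'.2.1]
    rw [hKL]
end
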